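/- (Fundamental theorem for concept lattices in rough set theory.) Let φ : A → B → Prop be a relation between sets A and B, and let X be a complete lattice. Then X is order-isomorphic to the object-oriented concept lattice Kφ if and only if there exist a join-dense map f : B → X and a meet-dense map g : A → X such that for all a ∈ A and b ∈ B one has ¬ φ a b ↔ f b ≤ g a. -/

import Mathlib

/-- `φ⁺ V = {x | ∃ y ∈ V, φ x y}`. -/
def kanDia {A B : Type*} (φ : A → B → Prop) (V : Set B) : Set A := {x | ∃ y ∈ V, φ x y}

/-- `φ₊ U = {y | ∀ x, φ x y → x ∈ U}`. -/
def kanBox {A B : Type*} (φ : A → B → Prop) (U : Set A) : Set B := {y | ∀ x, φ x y → x ∈ U}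

/-- A map `f : A → X` into a complete lattice is join-dense if every element of `X`
is a supremum of images of a subset of `A`. -/
def JoinDense {A X : Type*} [CompleteLattice X] (f : A → X) : Prop :=
  ∀ x : X, ∃ S : Set A, x = ⨆ a ∈ S, f a

/-- A map `g : B → X` into a complete lattice is meet-dense if every element of `X`
is an infimum of images of a subset of `B`. -/
def MeetDense {B X : Type*} [CompleteLattice X] (g : B → X) : Prop :=
  ∀ x : X, ∃ S : Set B, x = ⨅ b ∈ S, g b

theorem kanDia_subset_iff {A B : Type*} {φ : A → B → Prop} {V : Set B} {U : Set A} :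
    kanDia φ V ⊆ U ↔ V ⊆ kanBox φ U :=
  ⟨fun h y hy _ hxy => h ⟨y, hy, hxy⟩, fun h x ⟨_, hy, hxy⟩ => h hy x hxy⟩

theorem gc_kanDia_kanBox {A B : Type*} (φ : A → B → Prop) :
    GaloisConnection (kanDia φ) (kanBox φ) :=
  fun _ _ => kanDia_subset_iff

theorem JoinDense.iSup_le_eq {B X : Type*} [CompleteLattice X] {f : B → X} (hf : JoinDense f)
    (x : X) : ⨆ b ∈ {b | f b ≤ x}, f b = x := by
  refine le_antisymm (iSup₂_le fun _ hb => hb) ?_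
  obtain ⟨S, hS⟩ := hf x
  have hle : ∀ b ∈ S, f b ≤ x := fun b hb => hS ▸ le_iSup₂ (f := fun b (_ : b ∈ S) => f b) b hb
  calc x = ⨆ b ∈ S, f b := hS
    _ ≤ ⨆ b ∈ {b | f b ≤ x}, f b := biSup_mono hle

theorem MeetDense.le_iff {A X : Type*} [CompleteLattice X] {g : A → X} (hg : MeetDense g)
    {x y : X} : x ≤ y ↔ ∀ a, y ≤ g a → x ≤ g a := by
  refine ⟨fun h a ha => h.trans ha, fun h => ?_⟩
  obtain ⟨S, rfl⟩ := hg y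
  exact le_iInf₂ fun a ha => h a (iInf₂_le a ha)

/-- If `g` is meet-dense and `f b ≤ g a` encodes `¬ φ a b`, then the generators below the
supremum of `V` form the closure of `V`. -/
theorem MeetDense.setOf_le_iSup_eq {A B X : Type*} [CompleteLattice X] {φ : A → B → Prop}
    {f : B → X} {g : A → X} (hg : MeetDense g) (h : ∀ a b, ¬ φ a b ↔ f b ≤ g a) (V : Set B) :
    {b | f b ≤ ⨆ c ∈ V, f c} = kanBox φ (kanDia φ V) := by
  ext b
  change f b ≤ ⨆ c ∈ V, f c ↔ ∀ a, φ a b → ∃ c ∈ V, φ a c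
  rw [hg.le_iff]
  simp only [iSup_le_iff, ← h]
  refine forall_congr' fun a => ?_
  rw [← not_imp_not, not_not]
  push Not
  rfl

/-- The concept lattice representation of a complete lattice with suitable dense maps. -/
noncomputable def conceptOrderIso {A B X : Type*} [CompleteLattice X] {φ : A → B → Prop}
    {f : B → X} {g : A → X} (hf : JoinDense f) (hg : MeetDense g)
    (h : ∀ a b, ¬ φ a b ↔ f b ≤ g a) :
    X ≃o {V : Set B // kanBox φ (kanDia φ V) = V} where
  toFun x := ⟨{b | f b ≤ x}, by rw [← hg.setOf_le_iSup_eq h, hf.iSup_le_eq]⟩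
  invFun V := ⨆ b ∈ V.1, f b
  left_inv := hf.iSup_le_eq
  right_inv V := Subtype.ext ((hg.setOf_le_iSup_eq h V.1).trans V.2)
  map_rel_iff' {x y} := by
    refine ⟨fun hxy => ?_, fun hxy b hb => le_trans hb hxy⟩
    rw [← hf.iSup_le_eq x]
    exact iSup₂_le fun b hb => hxy hb

/-- A concept lattice carries a join-dense map from `B` and a meet-dense map from `A`. -/
theorem exists_dense_of_orderIso {A B X : Type*} [CompleteLattice X] {φ : A → B → Prop}
    (e : X ≃o {V : Set B // kanBox φ (kanDia φ V) = V}) :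
    ∃ (f : B → X) (g : A → X), JoinDense f ∧ MeetDense g ∧
      ∀ (a : A) (b : B), ¬ φ a b ↔ f b ≤ g a := by
  have gc := gc_kanDia_kanBox φ
  let f : B → X := fun b => e.symm ⟨kanBox φ (kanDia φ {b}), gc.u_l_u_eq_u _⟩
  let g : A → X := fun a => e.symm ⟨kanBox φ {a}ᶜ, gc.u_l_u_eq_u _⟩
  have hf : ∀ b x, f b ≤ x ↔ b ∈ (e x).1 := by
    intro b x
    rw [e.symm_apply_le, ← Subtype.coe_le_coe]
    change kanBox φ (kanDia φ {b}) ⊆ (e x).1 ↔ _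
    refine ⟨fun h => h (gc.le_u_l {b} rfl), fun h => ?_⟩
    rw [← (e x).2]
    exact gc.monotone_u (gc.monotone_l (Set.singleton_subset_iff.2 h))
  have hg : ∀ a x, x ≤ g a ↔ a ∉ kanDia φ (e x).1 := by
    intro a x
    rw [e.le_symm_apply, ← Subtype.coe_le_coe]
    change (e x).1 ⊆ kanBox φ {a}ᶜ ↔ _
    rw [← kanDia_subset_iff, Set.subset_compl_singleton_iff]
  refine ⟨f, g, fun x => ⟨(e x).1, ?_⟩, fun x => ⟨(kanDia φ (e x).1)ᶜ, ?_⟩, fun a b => ?_⟩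
  · refine le_antisymm ?_ (iSup₂_le fun b hb => (hf b x).2 hb)
    rw [← e.le_iff_le]
    exact fun b hb => (hf b _).1 (le_iSup₂ (f := fun b (_ : b ∈ (e x).1) => f b) b hb)
  · refine le_antisymm (le_iInf₂ fun a ha => (hg a x).2 ha) ?_
    rw [← e.le_iff_le, ← Subtype.coe_le_coe]
    refine Set.Subset.trans (b := kanBox φ (kanDia φ (e x).1)) ?_ (e x).2.subset
    intro b hb a hab
    by_contra ha
    exact (hg a _).1
      (iInf₂_le (f := fun a (_ : a ∈ (kanDia φ (e x).1)ᶜ) => g a) a ha) ⟨b, hb, hab⟩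
  · rw [hf, e.apply_symm_apply]
    exact ⟨fun h x hx hxa => h (hxa ▸ hx), fun h hab => h a hab rfl⟩

/-- fundamental theorem for concept lattices in RST: a complete
lattice `X` is order-isomorphic to the object-oriented concept lattice `Kφ` iff
there exist a join-dense map `f : B → X` and a meet-dense map `g : A → X` with
`¬ φ a b ↔ f b ≤ g a`. -/
theorem stmt3 {A B X : Type*} [CompleteLattice X] (φ : A → B → Prop) :
    Nonempty (X ≃o {V : Set B // kanBox φ (kanDia φ V) = V}) ↔
      ∃ (f : B → X) (g : A → X), JoinDense f ∧ MeetDense g ∧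
        ∀ (a : A) (b : B), ¬ φ a b ↔ f b ≤ g a := by
  exact ⟨fun ⟨e⟩ => exists_dense_of_orderIso e,
    fun ⟨_, _, hf, hg, h⟩ => ⟨conceptOrderIso hf hg h⟩⟩
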